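/- Let β > 0 and let G_β(x) = ∫_0^x ξ^{β−1} e^{−ξ} dξ / Γ(β) be the gamma CDF. Then for all y, z > 0 and every integer j ≥ 1, | (1/j!) · (d/dy)^j G_β(√(z/y)) | ≤ 2^{β/2} / (π · j · y^j), where (d/dy)^j denotes the j-th derivative with respect to y. -/

import Mathlib

open MeasureTheory Real

/-- The gamma(β,1) CDF `G_β(x) = ∫_0^x ξ^(β-1) e^(-ξ) dξ / Γ(β)`. -/
noncomputable def gammaCDF (β x : ℝ) : ℝ :=
  (∫ ξ in (0:ℝ)..x, ξ ^ (β - 1) * Real.exp (-ξ)) / Real.Gamma β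

open Filter Topology Set

theorem integral_mul_I_eq_zero_of_decay {g : ℂ → ℂ} {s : Set ℂ} (hs : s.Countable)
    (hc : ContinuousOn g {ζ | 0 ≤ ζ.re})
    (hd : ∀ ζ : ℂ, 0 < ζ.re → ζ ∉ s → DifferentiableAt ℂ g ζ) {C R₀ : ℝ}
    (hC : ∀ ζ : ℂ, 0 ≤ ζ.re → R₀ ≤ ‖ζ‖ → ‖g ζ‖ ≤ C / ‖ζ‖ ^ 2)
    (hi : Integrable fun t : ℝ => g (t * Complex.I)) :
    ∫ t : ℝ, g (t * Complex.I) = 0 := by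
  have h1 : Tendsto (fun R : ℝ => ∫ t in (-R)..R, g (t * Complex.I)) atTop
      (𝓝 (∫ t : ℝ, g (t * Complex.I))) :=
    intervalIntegral_tendsto_integral hi tendsto_neg_atTop_atBot tendsto_id
  refine tendsto_nhds_unique h1 ?_
  have hlim : Tendsto (fun R : ℝ => 4 * |C| * R⁻¹) atTop (𝓝 0) := by
    simpa using tendsto_inv_atTop_zero.const_mul (4 * |C|)
  refine squeeze_zero_norm' ?_ hlim
  filter_upwards [eventually_ge_atTop (max R₀ 1)] with R hR
  have hR0 : R₀ ≤ R := (le_max_left _ _).trans hR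
  have hRpos : 0 < R := zero_lt_one.trans_le ((le_max_right _ _).trans hR)
  have hrect := Complex.integral_boundary_rect_eq_zero_of_differentiable_on_off_countable g
    (⟨0, -R⟩ : ℂ) (⟨R, R⟩ : ℂ) s hs
    (hc.mono fun ζ hζ => by
      have := hζ.1
      simp only [mem_preimage, uIcc_of_le hRpos.le] at this
      exact this.1)
    (fun ζ hζ => hd ζ (by
      have := hζ.1.1
      simp only [mem_preimage, min_eq_left hRpos.le] at this
      exact this.1) hζ.2)
  simp only [Complex.ofReal_zero, zero_add, smul_eq_mul] at hrect
  have hbd : ∀ ζ : ℂ, 0 ≤ ζ.re → R ≤ ‖ζ‖ → ‖g ζ‖ ≤ |C| / R ^ 2 := fun ζ h0 h1 =>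
    (hC ζ h0 (hR0.trans h1)).trans (by gcongr; exact le_abs_self C)
  have e1 : ‖∫ x in (0 : ℝ)..R, g (x + (-R : ℝ) * Complex.I)‖ ≤ |C| / R ^ 2 * |R - 0| := by
    refine intervalIntegral.norm_integral_le_of_norm_le_const fun x hx => ?_
    rw [uIoc_of_le hRpos.le] at hx
    refine hbd _ (by simpa using hx.1.le) ?_
    simpa [abs_of_pos hRpos] using Complex.abs_im_le_norm ((x : ℂ) + (-R : ℝ) * Complex.I)
  have e2 : ‖∫ x in (0 : ℝ)..R, g (x + (R : ℝ) * Complex.I)‖ ≤ |C| / R ^ 2 * |R - 0| := by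
    refine intervalIntegral.norm_integral_le_of_norm_le_const fun x hx => ?_
    rw [uIoc_of_le hRpos.le] at hx
    refine hbd _ (by simpa using hx.1.le) ?_
    simpa [abs_of_pos hRpos] using Complex.abs_im_le_norm ((x : ℂ) + (R : ℝ) * Complex.I)
  have e3 : ‖∫ t in (-R)..R, g (R + t * Complex.I)‖ ≤ |C| / R ^ 2 * |R - -R| := by
    refine intervalIntegral.norm_integral_le_of_norm_le_const fun x _ => ?_
    refine hbd _ (by simpa using hRpos.le) ?_
    simpa [abs_of_pos hRpos] using Complex.abs_re_le_norm ((R : ℂ) + x * Complex.I)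
  set a := ∫ x in (0 : ℝ)..R, g (x + (-R : ℝ) * Complex.I)
  set b := ∫ x in (0 : ℝ)..R, g (x + (R : ℝ) * Complex.I)
  set c := ∫ t in (-R)..R, g (R + t * Complex.I)
  set d := ∫ t in (-R)..R, g (t * Complex.I)
  have hnd : ‖d‖ ≤ ‖a‖ + ‖b‖ + ‖c‖ := by
    have : Complex.I * d = a - b + Complex.I * c := by linear_combination -hrect
    calc ‖d‖ = ‖Complex.I * d‖ := by simp
      _ ≤ ‖a‖ + ‖b‖ + ‖Complex.I * c‖ := by
        rw [this]; exact (norm_add_le _ _).trans (by gcongr; exact norm_sub_le _ _)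
      _ = _ := by simp
  have : |C| / R ^ 2 * |R - 0| + |C| / R ^ 2 * |R - 0| + |C| / R ^ 2 * |R - -R|
      = 4 * |C| * R⁻¹ := by
    rw [sub_zero, sub_neg_eq_add, abs_of_pos hRpos, abs_of_pos (add_pos hRpos hRpos)]
    field_simp
    ring
  linarith

theorem sub_mul_I_ne_zero {y : ℝ} (hy : 0 < y) (t : ℝ) : (y : ℂ) - t * Complex.I ≠ 0 := by
  intro h
  have := congrArg Complex.re h
  simp at this
  exact hy.ne' this

theorem norm_inv_sub_mul_I_le {y : ℝ} (hy : 0 < y) (t : ℝ) :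
    ‖((y : ℂ) - t * Complex.I)⁻¹‖ ≤ y⁻¹ := by
  rw [norm_inv]
  refine inv_anti₀ hy ?_
  simpa [abs_of_pos hy] using Complex.abs_re_le_norm ((y : ℂ) - t * Complex.I)

theorem continuous_inv_sub_mul_I {y : ℝ} (hy : 0 < y) :
    Continuous fun t : ℝ => ((y : ℂ) - t * Complex.I)⁻¹ :=
  Continuous.inv₀ (by fun_prop) (sub_mul_I_ne_zero hy)

theorem integrable_mul_inv_sub_mul_I_pow {u : ℝ → ℂ} (hu : Integrable u) {y : ℝ} (hy : 0 < y)
    (m : ℕ) : Integrable fun t : ℝ => u t * ((y : ℂ) - t * Complex.I)⁻¹ ^ m :=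
  hu.mul_bdd (c := y⁻¹ ^ m) ((continuous_inv_sub_mul_I hy).pow m).aestronglyMeasurable
    (ae_of_all _ fun t => by
      rw [norm_pow]; exact pow_le_pow_left₀ (norm_nonneg _) (norm_inv_sub_mul_I_le hy t) m)

theorem integrable_and_integral_two_mul_div_sq_add_sq {y : ℝ} (hy : 0 < y) :
    (Integrable fun t : ℝ => 2 * y / (t ^ 2 + y ^ 2)) ∧
      ∫ t : ℝ, 2 * y / (t ^ 2 + y ^ 2) = 2 * π := by
  have h : (fun t : ℝ => 2 * y / (t ^ 2 + y ^ 2)) =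
      fun t : ℝ => 2 / y * (1 + (t / y) ^ 2)⁻¹ := by
    ext t
    field_simp
    ring
  rw [h]
  refine ⟨(integrable_inv_one_add_sq.comp_div hy.ne').const_mul _, ?_⟩
  rw [integral_const_mul, Measure.integral_comp_div (fun x : ℝ => (1 + x ^ 2)⁻¹),
    integral_univ_inv_one_add_sq, abs_of_pos hy, smul_eq_mul]
  field_simp

theorem integral_mul_inv_sub_mul_I {f : ℂ → ℂ} (hc : ContinuousOn f {ζ | 0 ≤ ζ.re})
    (hd : ∀ ζ : ℂ, 0 < ζ.re → DifferentiableAt ℂ f ζ) {C R₀ : ℝ}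
    (hC : ∀ ζ : ℂ, 0 ≤ ζ.re → R₀ ≤ ‖ζ‖ → ‖f ζ‖ ≤ C / ‖ζ‖)
    (hi : Integrable fun t : ℝ => f (t * Complex.I)) {y : ℝ} (hy : 0 < y) :
    ∫ t : ℝ, f (t * Complex.I) * ((y : ℂ) - t * Complex.I)⁻¹ = 2 * π * f y := by
  set N : ℂ → ℂ := fun ζ => f ζ - f y * (2 * y / (ζ + y)) with hN
  have hadd : ∀ ζ : ℂ, 0 ≤ ζ.re → ζ + y ≠ 0 := fun ζ hζ h => by
    have := congrArg Complex.re h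
    simp at this
    linarith
  have hNy : N y = 0 := by
    have : (y : ℂ) ≠ 0 := by exact_mod_cast hy.ne'
    simp only [hN]
    field_simp
    ring
  have hNd : ∀ ζ : ℂ, 0 < ζ.re → DifferentiableAt ℂ N ζ := fun ζ hζ => by
    have h1 := hadd ζ hζ.le
    have h2 := hd ζ hζ
    fun_prop (disch := assumption)
  have hNc : ContinuousOn N {ζ | 0 ≤ ζ.re} :=
    hc.sub (continuousOn_const.mul (ContinuousOn.div (by fun_prop) (by fun_prop)
      fun ζ hζ => hadd ζ hζ))
  have hslope : ∀ ζ : ℂ, ζ ≠ y → dslope N y ζ = (ζ - y)⁻¹ * N ζ := fun ζ hζ => by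
    rw [dslope_of_ne _ hζ, slope_def_module, hNy, sub_zero, smul_eq_mul]
  have haxis : (fun t : ℝ => dslope N y (t * Complex.I)) = fun t : ℝ =>
      f y * ((2 * y / (t ^ 2 + y ^ 2) : ℝ) : ℂ)
        - f (t * Complex.I) * ((y : ℂ) - t * Complex.I)⁻¹ := by
    ext t
    have h1 := sub_mul_I_ne_zero hy t
    have h2 := hadd (t * Complex.I) (by simp)
    have h3 : (t : ℂ) * Complex.I - y ≠ 0 := by rw [← neg_sub]; exact neg_ne_zero.2 h1
    have h4 : ((t : ℂ) ^ 2 + y ^ 2) = ((y : ℂ) - t * Complex.I) * (t * Complex.I + y) := by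
      linear_combination (t : ℂ) ^ 2 * Complex.I_sq
    rw [hslope _ (sub_ne_zero.1 h3)]
    push_cast
    rw [h4, ← neg_sub (y : ℂ)]
    simp only [hN]
    field_simp
    ring
  obtain ⟨hP, hPi⟩ := integrable_and_integral_two_mul_div_sq_add_sq hy
  have hP' : Integrable fun t : ℝ => f y * ((2 * y / (t ^ 2 + y ^ 2) : ℝ) : ℂ) :=
    hP.ofReal.const_mul _
  have hf' : Integrable fun t : ℝ => f (t * Complex.I) * ((y : ℂ) - t * Complex.I)⁻¹ := by
    simpa using integrable_mul_inv_sub_mul_I_pow hi hy 1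
  have hmem : {ζ : ℂ | 0 ≤ ζ.re} ∈ 𝓝 (y : ℂ) :=
    Filter.mem_of_superset ((isOpen_lt continuous_const Complex.continuous_re).mem_nhds
      (by simpa using hy : (y : ℂ) ∈ {ζ : ℂ | 0 < ζ.re})) fun ζ (hζ : 0 < ζ.re) => hζ.le
  have key : ∫ t : ℝ, dslope N y (t * Complex.I) = 0 := by
    refine integral_mul_I_eq_zero_of_decay (s := {(y : ℂ)}) (countable_singleton _)
      ((continuousOn_dslope hmem).2 ⟨hNc, hNd y (by simpa using hy)⟩)
      (fun ζ hζ hne => (differentiableAt_dslope_of_ne hne).2 (hNd ζ hζ))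
      (C := 2 * (C + 4 * y * ‖f y‖)) (R₀ := max R₀ (2 * y)) ?_ ?_
    · intro ζ hζ hζR
      have hR : R₀ ≤ ‖ζ‖ := (le_max_left _ _).trans hζR
      have h2y : 2 * y ≤ ‖ζ‖ := (le_max_right _ _).trans hζR
      have hpos : 0 < ‖ζ‖ := by linarith
      have hyn : ‖(y : ℂ)‖ = y := by simp [abs_of_pos hy]
      have h1 : ‖ζ‖ / 2 ≤ ‖ζ - y‖ := by
        have := norm_sub_norm_le ζ y
        rw [hyn] at this; linarith
      have h2 : ‖ζ‖ / 2 ≤ ‖ζ + y‖ := by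
        have := norm_sub_norm_le ζ (-y)
        rw [norm_neg, hyn, sub_neg_eq_add] at this; linarith
      have hne : ζ ≠ y := by
        rintro rfl
        rw [hyn] at h2y; linarith
      have hNn : ‖N ζ‖ ≤ (C + 4 * y * ‖f y‖) / ‖ζ‖ := by
        have h3 : ‖f y * (2 * y / (ζ + y))‖ ≤ ‖f y‖ * (2 * y / (‖ζ‖ / 2)) := by
          rw [norm_mul, norm_div, norm_mul, hyn, Complex.norm_two]
          gcongr
        calc ‖N ζ‖ ≤ ‖f ζ‖ + ‖f y * (2 * y / (ζ + y))‖ := norm_sub_le _ _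
          _ ≤ C / ‖ζ‖ + ‖f y‖ * (2 * y / (‖ζ‖ / 2)) := add_le_add (hC ζ hζ hR) h3
          _ = _ := by field_simp; ring
      rw [hslope ζ hne, norm_mul, norm_inv]
      calc ‖ζ - y‖⁻¹ * ‖N ζ‖ ≤ (‖ζ‖ / 2)⁻¹ * ((C + 4 * y * ‖f y‖) / ‖ζ‖) := by gcongr
        _ = _ := by field_simp
    · rw [haxis]
      exact hP'.sub hf'
  rw [haxis, integral_sub hP' hf', integral_const_mul, integral_complex_ofReal, hPi, sub_eq_zero] at key
  rw [← key]
  push_cast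
  ring

theorem hasDerivAt_integral_mul_inv_sub_mul_I_pow {u : ℝ → ℂ} (hu : Integrable u) (m : ℕ) {y : ℝ}
    (hy : 0 < y) :
    HasDerivAt (fun x : ℝ => ∫ t : ℝ, u t * ((x : ℂ) - t * Complex.I)⁻¹ ^ (m + 1))
      (-(m + 1) * ∫ t : ℝ, u t * ((y : ℂ) - t * Complex.I)⁻¹ ^ (m + 2)) y := by
  have hpos : ∀ x ∈ Ioi (y / 2), 0 < x := fun x hx => (half_pos hy).trans hx
  have := hasDerivAt_integral_of_dominated_loc_of_deriv_le (μ := volume) (x₀ := y)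
    (s := Ioi (y / 2)) (F := fun (x : ℝ) (t : ℝ) => u t * ((x : ℂ) - t * Complex.I)⁻¹ ^ (m + 1))
    (F' := fun (x : ℝ) (t : ℝ) => -(m + 1) * (u t * ((x : ℂ) - t * Complex.I)⁻¹ ^ (m + 2)))
    (bound := fun t => (m + 1) * (‖u t‖ * (y / 2)⁻¹ ^ (m + 2)))
    (Ioi_mem_nhds (by linarith)) ?_ (integrable_mul_inv_sub_mul_I_pow hu hy _)
    ((integrable_mul_inv_sub_mul_I_pow hu hy _).const_mul _).aestronglyMeasurable ?_
    ((hu.norm.mul_const _).const_mul _) ?_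
  · simpa only [integral_const_mul] using this.2
  · filter_upwards [Ioi_mem_nhds (show y / 2 < y by linarith)] with x hx
    exact (integrable_mul_inv_sub_mul_I_pow hu (hpos x hx) _).aestronglyMeasurable
  · refine ae_of_all _ fun t x hx => ?_
    have h1 : ‖(-((m : ℂ) + 1))‖ = m + 1 := by
      rw [norm_neg]; exact_mod_cast Complex.norm_natCast (m + 1)
    rw [norm_mul, h1, norm_mul, norm_pow]
    gcongr
    exact (norm_inv_sub_mul_I_le (hpos x hx) t).trans (inv_anti₀ (half_pos hy) (le_of_lt hx))
  · refine ae_of_all _ fun t x hx => ?_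
    have hne := sub_mul_I_ne_zero (hpos x hx) t
    have h0 : HasDerivAt (fun x : ℝ => (x : ℂ) - t * Complex.I) 1 x :=
      (HasDerivAt.ofReal_comp (hasDerivAt_id x)).sub_const _ |>.congr_deriv (by simp)
    refine (((h0.inv hne).pow (m + 1)).const_mul (u t)).congr_deriv ?_
    simp only [Pi.inv_apply, add_tsub_cancel_right]
    push_cast
    simp only [inv_pow]
    field_simp
    ring

theorem abs_iteratedDeriv_succ_le_of_hasDerivAt_re {f : ℂ → ℂ}
    (hc : ContinuousOn f {ζ | 0 ≤ ζ.re})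
    (hd : ∀ ζ : ℂ, 0 < ζ.re → DifferentiableAt ℂ f ζ) {C R₀ : ℝ}
    (hC : ∀ ζ : ℂ, 0 ≤ ζ.re → R₀ ≤ ‖ζ‖ → ‖f ζ‖ ≤ C / ‖ζ‖)
    (hi : Integrable fun t : ℝ => f (t * Complex.I)) {F : ℝ → ℝ} {A : ℝ}
    (hF : ∀ x : ℝ, 0 < x → HasDerivAt F (A * (f x).re) x) (m : ℕ) {y : ℝ} (hy : 0 < y) :
    |iteratedDeriv (m + 1) F y| ≤
      |A| * m.factorial / (2 * π) * (∫ t : ℝ, ‖f (t * Complex.I)‖) / y ^ (m + 1) := by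
  have key : ∀ m : ℕ, ∀ x : ℝ, 0 < x → iteratedDeriv (m + 1) F x =
      (((A * (-1) ^ m * m.factorial / (2 * π) : ℝ) : ℂ) *
        ∫ t : ℝ, f (t * Complex.I) * ((x : ℂ) - t * Complex.I)⁻¹ ^ (m + 1)).re := by
    intro m
    induction m with
    | zero =>
      intro x hx
      rw [zero_add, iteratedDeriv_one, (hF x hx).deriv]
      simp only [pow_one]
      rw [integral_mul_inv_sub_mul_I hc hd hC hi hx, Complex.re_ofReal_mul,
        show (2 * π * f x : ℂ) = ((2 * π : ℝ) : ℂ) * f x by push_cast; ring,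
        Complex.re_ofReal_mul]
      simp
      field_simp
    | succ m ih =>
      intro x hx
      rw [iteratedDeriv_succ]
      have heq : iteratedDeriv (m + 1) F =ᶠ[𝓝 x] fun x : ℝ =>
          (((A * (-1) ^ m * m.factorial / (2 * π) : ℝ) : ℂ) *
            ∫ t : ℝ, f (t * Complex.I) * ((x : ℂ) - t * Complex.I)⁻¹ ^ (m + 1)).re := by
        filter_upwards [Ioi_mem_nhds hx] with w hw using ih w hw
      have hder := Complex.reCLM.hasFDerivAt.comp_hasDerivAt x
        ((hasDerivAt_integral_mul_inv_sub_mul_I_pow hi m hx).const_mul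
          ((A * (-1) ^ m * m.factorial / (2 * π) : ℝ) : ℂ))
      rw [heq.deriv_eq]
      refine (hder.deriv).trans ?_
      rw [Complex.reCLM_apply, ← mul_assoc]
      congr 2
      push_cast [Nat.factorial_succ]
      ring
  rw [key m y hy]
  refine (Complex.abs_re_le_norm _).trans ?_
  have h1 : ‖A * (-1) ^ m * (m.factorial : ℝ) / (2 * π)‖ = |A| * m.factorial / (2 * π) := by
    rw [Real.norm_eq_abs, abs_div, abs_mul, abs_mul, abs_pow, abs_neg, abs_one, one_pow, mul_one,
      Nat.abs_cast, abs_of_pos (by positivity : (0 : ℝ) < 2 * π)]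
  have h2 : ‖∫ t : ℝ, f (t * Complex.I) * ((y : ℂ) - t * Complex.I)⁻¹ ^ (m + 1)‖ ≤
      (∫ t : ℝ, ‖f (t * Complex.I)‖) / y ^ (m + 1) := by
    rw [div_eq_mul_inv, ← integral_mul_const]
    refine norm_integral_le_of_norm_le (hi.norm.mul_const _) (ae_of_all _ fun t => ?_)
    rw [norm_mul, norm_pow, ← inv_pow]
    gcongr
    exact norm_inv_sub_mul_I_le hy t
  rw [norm_mul, Complex.norm_real, h1]
  exact (mul_le_mul_of_nonneg_left h2 (by positivity)).trans_eq (mul_div_assoc _ _ _).symm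

theorem hasDerivAt_gammaCDF {β : ℝ} (hβ : 0 < β) {x : ℝ} (hx : 0 < x) :
    HasDerivAt (gammaCDF β) (x ^ (β - 1) * Real.exp (-x) / Real.Gamma β) x := by
  have hc : ContinuousOn (fun ξ : ℝ => ξ ^ (β - 1) * Real.exp (-ξ)) (Ioi 0) := fun ξ hξ =>
    ((continuousAt_rpow_const ξ _ (Or.inl (ne_of_gt hξ))).mul
      (by fun_prop)).continuousWithinAt
  refine (intervalIntegral.integral_hasDerivAt_right ?_
    (hc.stronglyMeasurableAtFilter isOpen_Ioi x hx)
    (hc.continuousAt (Ioi_mem_nhds hx))).div_const _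
  rw [intervalIntegrable_iff_integrableOn_Ioc_of_le hx.le]
  refine ((Real.GammaIntegral_convergent hβ).mono_set Ioc_subset_Ioi_self).congr_fun
    (fun ξ _ => mul_comm _ _) measurableSet_Ioc

/-- Up to a real constant, the holomorphic extension to the right half-plane of the derivative of
`y ↦ G_β(k / √y)`. -/
noncomputable def gammaCDFKernel (β k : ℝ) (ζ : ℂ) : ℂ :=
  ζ ^ ((-(1 + β / 2) : ℝ) : ℂ) * Complex.exp (-(k * ζ ^ ((-(1 / 2) : ℝ) : ℂ)))

/-- The radial majorant of `gammaCDFKernel` on the right half-plane. -/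
noncomputable def gammaCDFMajorant (β c r : ℝ) : ℝ :=
  r ^ (-(1 + β / 2)) * Real.exp (-(c * r ^ (-(1 / 2) : ℝ)))

theorem hasDerivAt_gammaCDF_sqrt_div {β z x : ℝ} (hβ : 0 < β) (hz : 0 < z) (hx : 0 < x) :
    HasDerivAt (fun y => gammaCDF β (√(z / y)))
      (-(√z ^ β / (2 * Real.Gamma β)) * (gammaCDFKernel β (√z) x).re) x := by
  have hk : 0 < √z := Real.sqrt_pos.2 hz
  have heq : (fun y => gammaCDF β (√(z / y))) =ᶠ[𝓝 x]
      fun y => gammaCDF β (√z * y ^ (-(1 / 2) : ℝ)) := by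
    filter_upwards [Ioi_mem_nhds hx] with y hy
    rw [Real.sqrt_div hz.le, Real.rpow_neg (le_of_lt hy), ← Real.sqrt_eq_rpow, div_eq_mul_inv]
  refine HasDerivAt.congr_of_eventuallyEq ?_ heq
  have hpos : 0 < √z * x ^ (-(1 / 2) : ℝ) := by positivity
  have hinner : HasDerivAt (fun y : ℝ => √z * y ^ (-(1 / 2) : ℝ))
      (√z * (-(1 / 2) * x ^ (-(1 / 2) - 1 : ℝ))) x :=
    (Real.hasDerivAt_rpow_const (Or.inl hx.ne')).const_mul _
  refine ((hasDerivAt_gammaCDF hβ hpos).comp x hinner).congr_deriv ?_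
  have hre : (gammaCDFKernel β (√z) x).re =
      x ^ (-(1 + β / 2)) * Real.exp (-(√z * x ^ (-(1 / 2) : ℝ))) := by
    rw [gammaCDFKernel, ← Complex.ofReal_cpow hx.le, ← Complex.ofReal_cpow hx.le,
      ← Complex.ofReal_mul, ← Complex.ofReal_neg, ← Complex.ofReal_exp, ← Complex.ofReal_mul,
      Complex.ofReal_re]
  have h1 : x ^ (-(1 + β / 2)) = (x ^ (-(1 / 2) : ℝ)) ^ (β - 1) * x ^ (-(1 / 2) - 1 : ℝ) := by
    rw [← Real.rpow_mul hx.le, ← Real.rpow_add hx]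
    congr 1
    ring
  have h2 : √z ^ β = √z ^ (β - 1) * √z := by
    rw [← Real.rpow_add_one hk.ne', sub_add_cancel]
  rw [hre, h1, h2, Real.mul_rpow hk.le (by positivity)]
  ring

theorem norm_gammaCDFKernel_le {β k : ℝ} (hβ : 0 < β) (hk : 0 < k) {ζ : ℂ} (hζ : 0 ≤ ζ.re) :
    ‖gammaCDFKernel β k ζ‖ ≤ gammaCDFMajorant β (k * (√2 / 2)) ‖ζ‖ := by
  have hne : -(1 + β / 2) ≠ 0 := by linarith
  rcases eq_or_ne ζ 0 with rfl | h0
  · rw [gammaCDFKernel, gammaCDFMajorant, Complex.zero_cpow (by exact_mod_cast hne), norm_zero,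
      Real.zero_rpow hne]
    simp
  have harg := Complex.abs_arg_le_pi_div_two_iff.2 hζ
  have hcos : √2 / 2 ≤ Real.cos (Complex.arg ζ * (-(1 / 2))) := by
    rw [← Real.cos_pi_div_four, ← Real.cos_abs (Complex.arg ζ * _)]
    refine Real.cos_le_cos_of_nonneg_of_le_pi (abs_nonneg _) (by linarith [pi_pos]) ?_
    rw [abs_mul, abs_neg, abs_of_pos (by norm_num : (0 : ℝ) < 1 / 2)]
    linarith
  rw [gammaCDFKernel, gammaCDFMajorant, norm_mul, Complex.norm_cpow_of_ne_zero h0,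
    Complex.norm_exp, Complex.neg_re, Complex.re_ofReal_mul, Complex.cpow_ofReal_re]
  simp only [Complex.ofReal_re, Complex.ofReal_im, mul_zero, Real.exp_zero, div_one]
  have : k * (√2 / 2) * ‖ζ‖ ^ (-(1 / 2) : ℝ) ≤
      k * (‖ζ‖ ^ (-(1 / 2) : ℝ) * Real.cos (Complex.arg ζ * (-(1 / 2)))) := by
    rw [mul_assoc, mul_comm (√2 / 2)]
    gcongr
  gcongr

theorem gammaCDFMajorant_le_inv {β c r : ℝ} (hβ : 0 < β) (hc : 0 < c) (hr : 1 ≤ r) :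
    gammaCDFMajorant β c r ≤ 1 / r := by
  have h0 : 0 < r := zero_lt_one.trans_le hr
  have h1 : r ^ (-(1 + β / 2)) ≤ r ^ (-1 : ℝ) :=
    Real.rpow_le_rpow_of_exponent_le hr (by linarith)
  rw [Real.rpow_neg_one] at h1
  have h2 : Real.exp (-(c * r ^ (-(1 / 2) : ℝ))) ≤ 1 :=
    Real.exp_le_one_iff.2 (neg_nonpos.2 (by positivity))
  calc gammaCDFMajorant β c r ≤ r⁻¹ * 1 :=
        mul_le_mul h1 h2 (Real.exp_pos _).le (by positivity)
    _ = 1 / r := by ring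

theorem tendsto_gammaCDFMajorant_nhdsGT_zero (β : ℝ) {c : ℝ} (hc : 0 < c) :
    Tendsto (gammaCDFMajorant β c) (𝓝[>] 0) (𝓝 0) := by
  have h1 : Tendsto (fun r : ℝ => r ^ (-(1 / 2) : ℝ)) (𝓝[>] 0) atTop :=
    tendsto_rpow_neg_nhdsGT_zero (by norm_num)
  refine ((tendsto_rpow_mul_exp_neg_mul_atTop_nhds_zero (2 + β) c hc).comp h1).congr' ?_
  filter_upwards [self_mem_nhdsWithin] with r hr
  have hr0 : (0 : ℝ) < r := hr
  simp only [Function.comp_apply, gammaCDFMajorant, neg_mul]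
  rw [← Real.rpow_mul hr0.le]
  congr 2
  ring

theorem differentiableAt_gammaCDFKernel (β k : ℝ) {ζ : ℂ} (hζ : ζ ∈ Complex.slitPlane) :
    DifferentiableAt ℂ (gammaCDFKernel β k) ζ := by
  unfold gammaCDFKernel
  fun_prop (disch := assumption)

theorem continuousOn_gammaCDFKernel {β k : ℝ} (hβ : 0 < β) (hk : 0 < k) :
    ContinuousOn (gammaCDFKernel β k) {ζ | 0 ≤ ζ.re} := by
  intro ζ hζ
  rcases eq_or_ne ζ 0 with rfl | h0
  · rw [← continuousWithinAt_sdiff_self, ContinuousWithinAt]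
    have hzero : gammaCDFKernel β k 0 = 0 := by
      rw [gammaCDFKernel, Complex.zero_cpow, zero_mul]
      exact_mod_cast (by linarith : -(1 + β / 2) ≠ 0)
    rw [hzero]
    refine squeeze_zero_norm' ?_ (((tendsto_gammaCDFMajorant_nhdsGT_zero β
      (c := k * (√2 / 2)) (by positivity)).comp tendsto_norm_nhdsNE_zero).mono_left
        (nhdsWithin_mono 0 fun ζ hζ => hζ.2))
    filter_upwards [self_mem_nhdsWithin] with ζ hζ using norm_gammaCDFKernel_le hβ hk hζ.1
  · refine (differentiableAt_gammaCDFKernel β k ?_).continuousAt.continuousWithinAt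
    rw [Complex.mem_slitPlane_iff_not_le_zero]
    intro hle
    rw [Complex.nonpos_iff] at hle
    exact h0 (Complex.ext (le_antisymm hle.1 hζ) hle.2)

theorem integrable_and_integral_gammaCDFMajorant_abs {β c : ℝ} (hβ : 0 < β) (hc : 0 < c) :
    (Integrable fun t : ℝ => gammaCDFMajorant β c |t|) ∧
      ∫ t : ℝ, gammaCDFMajorant β c |t| = 4 * ((1 / c) ^ β * Real.Gamma β) := by
  set g : ℝ → ℝ := fun s => s ^ (β - 1) * Real.exp (-(c * s)) with hg
  have hp : (-(1 / 2) : ℝ) ≠ 0 := by norm_num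
  have heq : EqOn (fun x : ℝ => 2 * ((|(-(1 / 2) : ℝ)| * x ^ (-(1 / 2) - 1 : ℝ)) •
      g (x ^ (-(1 / 2) : ℝ)))) (gammaCDFMajorant β c) (Ioi 0) := by
    intro x hx
    have hx0 : (0 : ℝ) < x := hx
    have h1 : x ^ (-(1 + β / 2)) = x ^ (-(1 / 2) - 1 : ℝ) * (x ^ (-(1 / 2) : ℝ)) ^ (β - 1) := by
      rw [← Real.rpow_mul hx0.le, ← Real.rpow_add hx0]
      congr 1
      ring
    simp only [hg, gammaCDFMajorant, h1, smul_eq_mul, abs_neg,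
      abs_of_pos (by norm_num : (0 : ℝ) < 1 / 2)]
    ring
  have hgi : IntegrableOn g (Ioi 0) := by
    have := integrableOn_rpow_mul_exp_neg_mul_rpow (s := β - 1) (p := 1) (by linarith)
      one_pos hc
    simpa [hg] using this
  have hgint := Real.integral_rpow_mul_exp_neg_mul_Ioi hβ hc
  refine ⟨?_, ?_⟩
  · have h2 : IntegrableOn (gammaCDFMajorant β c) (Ioi 0) :=
      IntegrableOn.congr_fun (Integrable.const_mul
        ((integrableOn_Ioi_comp_rpow_iff g hp).2 hgi) 2) heq measurableSet_Ioi
    have := (integrable_fun_norm_addHaar (E := ℝ) volume (f := gammaCDFMajorant β c)).2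
      (by simpa using h2)
    simpa using this
  · rw [integral_comp_abs, ← setIntegral_congr_fun measurableSet_Ioi heq, integral_const_mul,
      integral_comp_rpow_Ioi g hp, hgint]
    ring

theorem integrable_gammaCDFKernel_mul_I {β k : ℝ} (hβ : 0 < β) (hk : 0 < k) :
    Integrable fun t : ℝ => gammaCDFKernel β k (t * Complex.I) := by
  refine (integrable_and_integral_gammaCDFMajorant_abs hβ
    (c := k * (√2 / 2)) (by positivity)).1.mono' ?_ (ae_of_all _ fun t => ?_)
  · exact ((continuousOn_gammaCDFKernel hβ hk).comp_continuous (by fun_prop)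
      fun t => by simp).aestronglyMeasurable
  · simpa using norm_gammaCDFKernel_le hβ hk (ζ := t * Complex.I) (by simp)

theorem integral_norm_gammaCDFKernel_mul_I_le {β k : ℝ} (hβ : 0 < β) (hk : 0 < k) :
    ∫ t : ℝ, ‖gammaCDFKernel β k (t * Complex.I)‖ ≤
      4 * (2 ^ (β / 2) / k ^ β * Real.Gamma β) := by
  obtain ⟨hM, hMi⟩ := integrable_and_integral_gammaCDFMajorant_abs hβ
    (c := k * (√2 / 2)) (by positivity)
  have hconst : (1 / (k * (√2 / 2))) ^ β = 2 ^ (β / 2) / k ^ β := by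
    have h2 : 1 / (k * (√2 / 2)) = √2 / k := by
      have := Real.mul_self_sqrt (zero_le_two (α := ℝ))
      field_simp
      linarith
    rw [h2, Real.div_rpow (Real.sqrt_nonneg 2) hk.le, Real.sqrt_eq_rpow,
      ← Real.rpow_mul zero_le_two]
    congr 2
    ring
  rw [← hconst, ← hMi]
  refine integral_mono (integrable_gammaCDFKernel_mul_I hβ hk).norm hM fun t => ?_
  simpa using norm_gammaCDFKernel_le hβ hk (ζ := t * Complex.I) (by simp)

/-- **Lemma A.1.** For `β > 0`, all `y, z > 0` and every integer `j ≥ 1`,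
`|(1/j!) (d/dy)^j G_β(√(z/y))| ≤ 2^(β/2) / (π j y^j)`. -/
theorem gammaCDF_deriv_bound
    (β : ℝ) (hβ : 0 < β) (y z : ℝ) (hy : 0 < y) (hz : 0 < z)
    (j : ℕ) (hj : 1 ≤ j) :
    |(1 / (j.factorial : ℝ)) *
        iteratedDeriv j (fun y' => gammaCDF β (Real.sqrt (z / y'))) y|
      ≤ 2 ^ (β / 2) / (π * j * y ^ j) := by
  obtain ⟨m, rfl⟩ : ∃ m, j = m + 1 := ⟨j - 1, by omega⟩
  have hk : 0 < √z := Real.sqrt_pos.2 hz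
  have hΓ := Real.Gamma_pos_of_pos hβ
  have hmain := abs_iteratedDeriv_succ_le_of_hasDerivAt_re
    (continuousOn_gammaCDFKernel hβ hk)
    (fun ζ hζ => differentiableAt_gammaCDFKernel β (√z) (Or.inl hζ)) (C := 1) (R₀ := 1)
    (fun ζ hζ h1 => (norm_gammaCDFKernel_le hβ hk hζ).trans
      (gammaCDFMajorant_le_inv hβ (by positivity) h1))
    (integrable_gammaCDFKernel_mul_I hβ hk)
    (fun x hx => hasDerivAt_gammaCDF_sqrt_div hβ hz hx) m hy
  have hint := integral_norm_gammaCDFKernel_mul_I_le hβ hk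
  rw [abs_neg, abs_of_pos (by positivity : 0 < √z ^ β / (2 * Real.Gamma β))] at hmain
  rw [abs_mul, abs_of_pos (by positivity : 0 < 1 / ((m + 1).factorial : ℝ))]
  calc _ ≤ 1 / ((m + 1).factorial : ℝ) * (√z ^ β / (2 * Real.Gamma β) * m.factorial / (2 * π) *
        (4 * (2 ^ (β / 2) / √z ^ β * Real.Gamma β)) / y ^ (m + 1)) := by
        gcongr
        exact hmain.trans (by gcongr)
    _ = 2 ^ (β / 2) / (π * ((m + 1 : ℕ) : ℝ) * y ^ (m + 1)) := by
        have h1 : √z ^ β ≠ 0 := by positivity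
        have h2 : (m.factorial : ℝ) ≠ 0 := by positivity
        rw [Nat.factorial_succ]
        push_cast
        field_simp
        ring
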